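/- Let 𝔽 be a field, let 𝔽[x₁,…,xₙ] be the polynomial ring in n variables over 𝔽, and let J be the ideal generated by {x_i² − x_i : i ∈ [n]}. Then every ideal I of 𝔽[x₁,…,xₙ] with J ⊆ I is a radical ideal. -/

import Mathlib

open Finset

/-- Every ideal of `𝔽[x₁,…,xₙ]` containing `{xᵢ² − xᵢ : i ∈ [n]}` is radical. -/
theorem stmt_15 (𝔽 : Type*) [Field 𝔽] (n : ℕ)
    (I : Ideal (MvPolynomial (Fin n) 𝔽))
    (hJ : Ideal.span {p : MvPolynomial (Fin n) 𝔽 |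
      ∃ i : Fin n, p = MvPolynomial.X i ^ 2 - MvPolynomial.X i} ≤ I) :
    I.IsRadical := by
  classical
  have hy : ∀ i, Ideal.Quotient.mk I (MvPolynomial.X i) * Ideal.Quotient.mk I (MvPolynomial.X i)
      = Ideal.Quotient.mk I (MvPolynomial.X i) := by
    intro i
    rw [← map_mul, Ideal.Quotient.eq, ← pow_two]
    exact hJ (Ideal.subset_span ⟨i, rfl⟩)
  generalize hq : Ideal.Quotient.mk I = q at hy
  have hmem : ∀ f, f ∈ I ↔ q f = 0 := by
    intro f; rw [← hq]; exact Ideal.Quotient.eq_zero_iff_mem.symm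
  let P : Finset (Fin n) → MvPolynomial (Fin n) 𝔽 ⧸ I := fun t =>
    (∏ i ∈ t, q (MvPolynomial.X i)) * ∏ i ∈ univ \ t, (1 - q (MvPolynomial.X i))
  have hsum : ∑ t ∈ (univ : Finset (Fin n)).powerset, P t = 1 := by
    have h := Finset.prod_add (fun i => q (MvPolynomial.X i))
      (fun i => 1 - q (MvPolynomial.X i)) (univ : Finset (Fin n))
    rw [← h]
    simp
  have hev : ∀ (t : Finset (Fin n)) (f : MvPolynomial (Fin n) 𝔽),
      q f * P t = q (MvPolynomial.C (MvPolynomial.eval (fun i => if i ∈ t then 1 else 0) f)) * P t := by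
    intro t f
    induction f using MvPolynomial.induction_on with
    | C a => simp
    | add f g hf hg => simp only [map_add, add_mul, hf, hg]
    | mul_X f i hf =>
      have hX : q (MvPolynomial.X i) * P t = (if i ∈ t then 1 else 0) * P t := by
        by_cases hi : i ∈ t
        · simp only [P, hi, if_true, one_mul]
          rw [← Finset.mul_prod_erase t _ hi, ← mul_assoc, ← mul_assoc, hy]
        · have hi' : i ∈ univ \ t := by simp [hi]
          simp only [P, hi, if_false, zero_mul]
          rw [← Finset.mul_prod_erase _ _ hi']
          linear_combination (-(∏ i ∈ t, q (MvPolynomial.X i)) *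
            ∏ x ∈ (univ \ t).erase i, (1 - q (MvPolynomial.X x))) * hy i
      rw [map_mul, mul_assoc, hX, mul_left_comm, hf]
      by_cases hi : i ∈ t <;> simp [hi]
  rintro f ⟨k, hk⟩
  rw [hmem] at hk ⊢
  rw [← mul_one (q f), ← hsum, Finset.mul_sum]
  refine Finset.sum_eq_zero fun t _ => ?_
  have h := hev t (f ^ k)
  rw [hk, zero_mul, map_pow] at h
  rw [hev t f]
  generalize MvPolynomial.eval (fun i => if i ∈ t then (1 : 𝔽) else 0) f = c at h
  by_cases hc : c = 0
  · simp [hc]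
  · have : P t = q (MvPolynomial.C ((c ^ k)⁻¹)) * (q (MvPolynomial.C (c ^ k)) * P t) := by
      rw [← mul_assoc, ← map_mul, ← map_mul, inv_mul_cancel₀ (pow_ne_zero k hc)]
      simp
    rw [this, ← h]
    simp
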